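/- Let n, m ≥ 1. Let e : (Fin n × ZMod 2) ⊕ (Fin m × ZMod 2) ≃ (Fin n ⊕ Fin m) × ZMod 2 be the canonical equivalence and let ι : Equiv.Perm (Fin n × ZMod 2) × Equiv.Perm (Fin m × ZMod 2) → Equiv.Perm ((Fin n ⊕ Fin m) × ZMod 2) be the injective group homomorphism ι(f, g) = e.permCongr (Equiv.sumCongr f g) (the block inclusion Bₙ × Bₘ → B_{n+m}). Let B(α) denote the subgroup of Equiv.Perm (α × ZMod 2) of permutations commuting with the negation (a, ε) ↦ (a, ε + 1), and D(α) = B(α) ⊓ alternatingGroup (α × ZMod 2). Then the image under ι of D(Fin n) × D(Fin m) is a subgroup of index 2 in the subgroup ι(B(Fin n) × B(Fin m)) ⊓ D(Fin n ⊕ Fin m). (The subgroup Dₙ × Dₘ has even index in G = D_{n+m} ∩ (Bₙ × Bₘ), which forces the vanishing of the composite of restriction and transfer mod 2.) -/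

import Mathlib

/-- The global sign change on `α × ZMod 2`: `(a, ε) ↦ (a, ε + 1)`. -/
def negPermT (α : Type*) : Equiv.Perm (α × ZMod 2) :=
  Equiv.prodCongr (Equiv.refl α) (Equiv.addRight (1 : ZMod 2))

/-- The hyperoctahedral group `B(α)`: the permutations of `α × ZMod 2` commuting with the
global sign change. -/
def hyperBT (α : Type*) : Subgroup (Equiv.Perm (α × ZMod 2)) :=
  Subgroup.centralizer {negPermT α}

/-- The group `D(α)` of even signed permutations. -/
def hyperDT (α : Type*) [Fintype α] [DecidableEq α] : Subgroup (Equiv.Perm (α × ZMod 2)) :=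
  hyperBT α ⊓ alternatingGroup (α × ZMod 2)

/-- The canonical equivalence `(Fin n × ZMod 2) ⊕ (Fin m × ZMod 2) ≃ (Fin n ⊕ Fin m) × ZMod 2`. -/
def blockEquiv (n m : ℕ) : (Fin n × ZMod 2) ⊕ (Fin m × ZMod 2) ≃ (Fin n ⊕ Fin m) × ZMod 2 :=
  (Equiv.sumProdDistrib (Fin n) (Fin m) (ZMod 2)).symm

theorem aux_ex_odd (k : ℕ) (hk : 1 ≤ k) : ∃ s : Equiv.Perm (Fin k × ZMod 2),
    s ∈ hyperBT (Fin k) ∧ Equiv.Perm.sign s = -1 := by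
  refine ⟨Equiv.swap (⟨0, hk⟩, 0) (⟨0, hk⟩, 1), ?_, ?_⟩
  · rw [hyperBT, Subgroup.mem_centralizer_singleton_iff]
    have h := Equiv.mul_swap_eq_swap_mul (negPermT (Fin k)) (⟨0, hk⟩, 0) (⟨0, hk⟩, 1)
    have h0 : negPermT (Fin k) (⟨0, hk⟩, 0) = (⟨0, hk⟩, 1) := rfl
    have h1 : negPermT (Fin k) (⟨0, hk⟩, 1) = (⟨0, hk⟩, 0) := rfl
    rw [h0, h1, Equiv.swap_comm ((⟨0, hk⟩, 1) : Fin k × ZMod 2)] at h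
    first | exact h | exact h.symm
  · exact Equiv.Perm.sign_swap (by simp)

theorem aux_block_mem (n m : ℕ) (f : Equiv.Perm (Fin n × ZMod 2))
    (g : Equiv.Perm (Fin m × ZMod 2)) (hf : f ∈ hyperBT (Fin n)) (hg : g ∈ hyperBT (Fin m)) :
    (blockEquiv n m).permCongr (Equiv.sumCongr f g) ∈ hyperBT (Fin n ⊕ Fin m) := by
  rw [hyperBT, Subgroup.mem_centralizer_singleton_iff] at *
  ext1 ⟨x, ε⟩
  rcases x with x | x
  · have h := DFunLike.congr_fun hf (x, ε)
    exact congrArg (fun p => blockEquiv n m (Sum.inl p)) h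
  · have h := DFunLike.congr_fun hg (x, ε)
    exact congrArg (fun p => blockEquiv n m (Sum.inr p)) h

/-- The block inclusion as a homomorphism. -/
def blockHom (n m : ℕ) : Equiv.Perm (Fin n × ZMod 2) × Equiv.Perm (Fin m × ZMod 2) →*
    Equiv.Perm ((Fin n ⊕ Fin m) × ZMod 2) where
  toFun p := (blockEquiv n m).permCongr (Equiv.sumCongr p.1 p.2)
  map_one' := by
    ext1 ⟨x, ε⟩
    rcases x with x | x <;> rfl
  map_mul' p q := by
    ext1 ⟨x, ε⟩
    rcases x with x | x <;> rfl

theorem blockHom_injective (n m : ℕ) : Function.Injective (blockHom n m) := by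
  intro p q h
  have h' := (blockEquiv n m).permCongr.injective h
  exact Equiv.Perm.sumCongrHom_injective (α := Fin n × ZMod 2) (β := Fin m × ZMod 2) h'

theorem sign_blockHom (n m : ℕ) (f : Equiv.Perm (Fin n × ZMod 2))
    (g : Equiv.Perm (Fin m × ZMod 2)) :
    Equiv.Perm.sign (blockHom n m (f, g)) = Equiv.Perm.sign f * Equiv.Perm.sign g := by
  change Equiv.Perm.sign ((blockEquiv n m).permCongr (Equiv.sumCongr f g)) = _
  rw [Equiv.Perm.sign_permCongr]
  exact Equiv.Perm.sign_sumCongr f g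

/-- under the block inclusion `ι : Bₙ × Bₘ → B_{n+m}`,
`ι(f, g) = e.permCongr (Equiv.sumCongr f g)`, the image of `Dₙ × Dₘ` has index 2 in
`ι(Bₙ × Bₘ) ⊓ D_{n+m}`. -/
theorem image_D_prod_D_index_two (n m : ℕ) (hn : 1 ≤ n) (hm : 1 ≤ m) :
    ∃ ι : Equiv.Perm (Fin n × ZMod 2) × Equiv.Perm (Fin m × ZMod 2) →*
        Equiv.Perm ((Fin n ⊕ Fin m) × ZMod 2),
      (∀ (f : Equiv.Perm (Fin n × ZMod 2)) (g : Equiv.Perm (Fin m × ZMod 2)),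
        ι (f, g) = (blockEquiv n m).permCongr (Equiv.sumCongr f g)) ∧
      Function.Injective ι ∧
      Subgroup.relIndex
          (Subgroup.map ι ((hyperDT (Fin n)).prod (hyperDT (Fin m))))
          ((Subgroup.map ι ((hyperBT (Fin n)).prod (hyperBT (Fin m))))
            ⊓ hyperDT (Fin n ⊕ Fin m))
        = 2 := by
  refine ⟨blockHom n m, fun _ _ => rfl, blockHom_injective n m, ?_⟩
  rw [Subgroup.relIndex_eq_two_iff]
  obtain ⟨s, hs, hs'⟩ := aux_ex_odd n hn
  obtain ⟨t, ht, ht'⟩ := aux_ex_odd m hm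
  refine ⟨blockHom n m (s, t), ⟨⟨(s, t), ⟨hs, ht⟩, rfl⟩, aux_block_mem n m s t hs ht, ?_⟩, ?_⟩
  · change _ ∈ alternatingGroup _
    rw [Equiv.Perm.mem_alternatingGroup, sign_blockHom, hs', ht']
    rfl
  · rintro b ⟨⟨⟨f, g⟩, ⟨hf, hg⟩, rfl⟩, -, hb⟩
    change _ ∈ alternatingGroup _ at hb
    change f ∈ hyperBT (Fin n) at hf
    change g ∈ hyperBT (Fin m) at hg
    rw [Equiv.Perm.mem_alternatingGroup, sign_blockHom] at hb
    rw [← map_mul, Subgroup.mem_map_iff_mem (blockHom_injective n m),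
      Subgroup.mem_map_iff_mem (blockHom_injective n m), Prod.mk_mul_mk,
      Subgroup.mem_prod, Subgroup.mem_prod]
    simp only [hyperDT, Subgroup.mem_inf, Equiv.Perm.mem_alternatingGroup, mul_mem hf hs,
      mul_mem hg ht, hf, hg, true_and, map_mul, hs', ht']
    rcases Int.units_eq_one_or (Equiv.Perm.sign f) with h | h <;>
    rcases Int.units_eq_one_or (Equiv.Perm.sign g) with h' | h' <;>
    rw [h, h'] at hb ⊢ <;> revert hb <;> decide
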